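/- arXiv:math/0510303 — 2 statements merged into one kernel-verified Lean document; each statement's English description precedes it below -/
import Mathlib

section
/- The monotone refinement property fails in F(ω₁): there exist no isotone ω₁-indexed sequences (a_ξ)_{ξ<ω₁} and (b_ξ)_{ξ<ω₁} of elements of F(ω₁) such that a_ξ ≤ a, b_ξ ≤ b, and c_ξ = a_ξ ∨ b_ξ for all ξ < ω₁. -/
section Tower

variable {D : Type*} [SemilatticeSup D] [OrderBot D]

/-- `x` is a reduced finite subset of `C(A)`, for a subset `A` of the ambient
`∨,0`-semilattice `D`. -/
def IsReducedIn (A : Set D) (x : Set (D × D × D)) : Prop :=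
  x.Finite ∧
  (∀ t ∈ x, t.1 ∈ A ∧ t.2.1 ∈ A ∧ t.2.2 ∈ A ∧ t.2.2 ≤ t.1 ⊔ t.2.1) ∧
  (∃! u : D, (u, u, u) ∈ x) ∧
  (∀ u v w : D, (u, v, w) ∈ x → (v, u, w) ∈ x → u = v ∧ v = w) ∧
  (∀ p u v w : D, (p, p, p) ∈ x → (u, v, w) ∈ x → (u, v, w) ≠ (p, p, p) →
    ¬u ≤ p ∧ ¬v ≤ p ∧ ¬w ≤ p)

/-- The coordinate of the (unique, for a reduced set) diagonal triple of `x`. -/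
noncomputable def piIn (x : Set (D × D × D)) : D := by
  classical exact if h : ∃ u : D, (u, u, u) ∈ x then h.choose else ⊥

/-- The partial order between reduced sets. -/
def RleIn (x y : Set (D × D × D)) : Prop :=
  ∀ t ∈ x \ y, t.1 ≤ piIn y ∨ t.2.2 ≤ piIn y

/-- A realization, inside an ambient `∨,0`-semilattice `D`, of the increasing chain
`S0 = R⁰(S0) ⊆ R¹(S0) ⊆ R²(S0) ⊆ …` of iterated free distributive extensions whose union
`D(S0)` is all of `D` : `T n` realizes `Rⁿ(S0)`, and `φ n` is the canonical bijection from
the set of reduced subsets of `C(T n)` onto `T (n+1)`, which is an order-isomorphism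
fixing `T n` (identified with the diagonal singletons). -/
structure RTower (D : Type*) [SemilatticeSup D] [OrderBot D] (S0 : Set D) where
  T : ℕ → Set D
  φ : (n : ℕ) → {x : Set (D × D × D) // IsReducedIn (T n) x} → D
  T_zero : T 0 = S0
  bot_mem : ∀ n, (⊥ : D) ∈ T n
  sup_mem : ∀ n, ∀ x ∈ T n, ∀ y ∈ T n, x ⊔ y ∈ T n
  phi_range : ∀ n, Set.range (φ n) = T (n + 1)
  phi_inj : ∀ n, Function.Injective (φ n)
  phi_diag : ∀ (n : ℕ) (x : {x : Set (D × D × D) // IsReducedIn (T n) x}) (a : D),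
    x.1 = {(a, a, a)} → φ n x = a
  phi_le : ∀ (n : ℕ) (x y : {x : Set (D × D × D) // IsReducedIn (T n) x}),
    φ n x ≤ φ n y ↔ RleIn x.1 y.1
  union_univ : (⋃ n, T n) = (Set.univ : Set D)

/-- The realization, inside `D`, of the `n`-th level `Rⁿ(B)` of the free distributive
extension of a `∨,0`-subsemilattice `B ⊆ S0`. -/
def RTower.FXn {S0 : Set D} (tw : RTower D S0) (B : Set D) : ℕ → Set D
  | 0 => B
  | n + 1 => {d | ∃ x : {x : Set (D × D × D) // IsReducedIn (tw.T n) x},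
      tw.φ n x = d ∧ ∀ t ∈ x.1, t.1 ∈ tw.FXn B n ∧ t.2.1 ∈ tw.FXn B n ∧ t.2.2 ∈ tw.FXn B n}

/-- The realization, inside `D`, of the free distributive extension `D(B)` of a
`∨,0`-subsemilattice `B ⊆ S0`. -/
def RTower.FX {S0 : Set D} (tw : RTower D S0) (B : Set D) : Set D := ⋃ n, tw.FXn B n

end Tower
section SLam

/-- A realization, inside an ambient `∨,0`-semilattice `D`, of the `∨,0`-semilattice `S(Λ)`
presented by generators `a`, `b`, `cᵢ` (for `i ∈ Λ`) and relations `cᵢ ≤ a ⊔ b` and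
`cᵢ ≤ c j` for `i ≤ j`: the listed conditions say exactly that the `∨,0`-subsemilattice
generated by `a`, `b` and the `cᵢ` is freely presented by those relations. -/
structure SLamData (D : Type*) [SemilatticeSup D] [OrderBot D]
    (Λ : Type*) [LinearOrder Λ] where
  a : D
  b : D
  c : Λ → D
  c_mono : Monotone c
  c_le_ab : ∀ i, c i ≤ a ⊔ b
  not_a_le : ∀ i, ¬ a ≤ b ⊔ c i
  not_b_le : ∀ i, ¬ b ≤ a ⊔ c i
  not_a_le_b : ¬ a ≤ b
  not_b_le_a : ¬ b ≤ a
  not_c_le_a : ∀ i, ¬ c i ≤ a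
  not_c_le_b : ∀ i, ¬ c i ≤ b
  c_le_a_sup_c : ∀ i j, c i ≤ a ⊔ c j → i ≤ j
  c_le_b_sup_c : ∀ i j, c i ≤ b ⊔ c j → i ≤ j

/-- The `∨,0`-subsemilattice `S(X)` of `S(Λ)` generated by `{0, a, b, a ⊔ b} ∪ {cᵢ : i ∈ X}`,
realized inside the ambient semilattice `D`. -/
def SLamData.SX {D : Type*} [SemilatticeSup D] [OrderBot D] {Λ : Type*} [LinearOrder Λ]
    (sd : SLamData D Λ) (X : Set Λ) : Set D :=
  supClosure ({⊥, sd.a, sd.b, sd.a ⊔ sd.b} ∪ sd.c '' X)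

end SLam
/-- The first uncountable ordinal `ω₁`, viewed as a chain: the linearly ordered set of
all ordinals `< ω₁`. -/
noncomputable abbrev Omega1 : Type 1 := {o : Ordinal // o < (Cardinal.aleph 1).ord}


section ReducedSets

variable {D : Type*} [SemilatticeSup D]

/-- Adjoining a new diagonal triple to a set of triples, none of whose entries lies below it, gives
a reduced set, provided no triple occurs together with its mirror image. -/
theorem isReducedIn_insert_diag {A : Set D} {p : D} (hp : p ∈ A) {s : Set (D × D × D)}
    (hs : s.Finite)
    (hA : ∀ t ∈ s, t.1 ∈ A ∧ t.2.1 ∈ A ∧ t.2.2 ∈ A ∧ t.2.2 ≤ t.1 ⊔ t.2.1)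
    (hmirror : ∀ u v w : D, (u, v, w) ∈ s → (v, u, w) ∉ s)
    (hnot_le : ∀ t ∈ s, ¬t.1 ≤ p ∧ ¬t.2.1 ≤ p ∧ ¬t.2.2 ≤ p) :
    IsReducedIn A (insert (p, p, p) s) := by
  have hdiag : ∀ u : D, (u, u, u) ∈ insert (p, p, p) s → u = p := by
    rintro u (h | h)
    · simpa using h
    · exact absurd h (hmirror u u u h)
  refine ⟨hs.insert _, ?_, ⟨p, Set.mem_insert _ _, hdiag⟩, ?_, ?_⟩
  · rintro t (rfl | ht)
    · exact ⟨hp, hp, hp, le_sup_left⟩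
    · exact hA t ht
  · rintro u v w (h | h) (h' | h')
    · simp only [Prod.mk.injEq] at h
      obtain ⟨rfl, rfl, rfl⟩ := h
      exact ⟨rfl, rfl⟩
    · simp only [Prod.mk.injEq] at h
      obtain ⟨rfl, rfl, rfl⟩ := h
      exact ⟨rfl, rfl⟩
    · simp only [Prod.mk.injEq] at h'
      obtain ⟨rfl, rfl, rfl⟩ := h'
      exact ⟨rfl, rfl⟩
    · exact absurd h' (hmirror u v w h)
  · rintro q u v w hq ht hne
    obtain rfl := hdiag q hq
    exact hnot_le _ (ht.resolve_left hne)

theorem isReducedIn_singleton {A : Set D} {p : D} (hp : p ∈ A) :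
    IsReducedIn A {(p, p, p)} := by
  have := isReducedIn_insert_diag (A := A) hp Set.finite_empty (by simp) (by simp) (by simp)
  simpa using this

variable [OrderBot D]

theorem IsReducedIn.piIn_mem {A : Set D} {x : Set (D × D × D)} (hx : IsReducedIn A x) :
    (piIn x, piIn x, piIn x) ∈ x := by
  have h : ∃ u : D, (u, u, u) ∈ x := hx.2.2.1.exists
  unfold piIn
  rw [dif_pos h]
  exact h.choose_spec

theorem IsReducedIn.eq_piIn {A : Set D} {x : Set (D × D × D)} (hx : IsReducedIn A x) {u : D}
    (hu : (u, u, u) ∈ x) : u = piIn x :=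
  hx.2.2.1.unique hu hx.piIn_mem

theorem IsReducedIn.piIn_insert_diag {A : Set D} {p : D} {s : Set (D × D × D)}
    (h : IsReducedIn A (insert (p, p, p) s)) : piIn (insert (p, p, p) s) = p :=
  (h.eq_piIn (Set.mem_insert _ _)).symm

theorem IsReducedIn.not_le_piIn {A : Set D} {x : Set (D × D × D)} (hx : IsReducedIn A x)
    {t : D × D × D} (ht : t ∈ x) (hne : t ≠ (piIn x, piIn x, piIn x)) :
    ¬t.1 ≤ piIn x ∧ ¬t.2.1 ≤ piIn x ∧ ¬t.2.2 ≤ piIn x :=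
  hx.2.2.2.2 (piIn x) t.1 t.2.1 t.2.2 hx.piIn_mem ht hne

/-- If both `(u, v, w)` and `(v, u, w)` are absorbed by `z`, then so is `w`. -/
theorem IsReducedIn.le_piIn_of_mirror {A : Set D} {z : Set (D × D × D)} (hz : IsReducedIn A z)
    {u v w : D} (hw : w ≤ u ⊔ v)
    (h₁ : (u, v, w) ∈ z ∨ u ≤ piIn z ∨ w ≤ piIn z)
    (h₂ : (v, u, w) ∈ z ∨ v ≤ piIn z ∨ w ≤ piIn z) : w ≤ piIn z := by
  by_contra hcon
  have hne : ∀ p q : D, (p, q, w) ≠ (piIn z, piIn z, piIn z) := by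
    intro p q h
    simp only [Prod.mk.injEq] at h
    exact hcon h.2.2.le
  rcases h₁ with h₁ | h₁ | h₁
  · have hn := hz.not_le_piIn h₁ (hne _ _)
    rcases h₂ with h₂ | h₂ | h₂
    · obtain ⟨rfl, rfl⟩ := hz.2.2.2.1 u v w h₁ h₂
      exact hcon (hz.eq_piIn h₁).le
    · exact hn.2.1 h₂
    · exact hcon h₂
  · rcases h₂ with h₂ | h₂ | h₂
    · exact (hz.not_le_piIn h₂ (hne _ _)).2.1 h₁
    · exact hcon (hw.trans (sup_le h₁ h₂))
    · exact hcon h₂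
  · exact hcon h₁

end ReducedSets

namespace RTower

variable {D : Type*} [SemilatticeSup D] [OrderBot D] {S0 : Set D} (tw : RTower D S0)

theorem phi_le_iff {n : ℕ} (x y : {x : Set (D × D × D) // IsReducedIn (tw.T n) x}) :
    tw.φ n x ≤ tw.φ n y ↔
      ∀ t ∈ x.1, t ∈ y.1 ∨ t.1 ≤ piIn y.1 ∨ t.2.2 ≤ piIn y.1 := by
  rw [tw.phi_le]
  constructor
  · intro h t ht
    by_cases hy : t ∈ y.1
    · exact Or.inl hy
    · exact Or.inr (h t ⟨ht, hy⟩)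
  · intro h t ht
    exact (h t ht.1).resolve_left ht.2

theorem le_phi_iff {n : ℕ} {u : D} (hu : u ∈ tw.T n)
    (y : {x : Set (D × D × D) // IsReducedIn (tw.T n) x}) :
    u ≤ tw.φ n y ↔ u ≤ piIn y.1 := by
  have hx := isReducedIn_singleton hu
  conv_lhs => rw [← tw.phi_diag n ⟨_, hx⟩ u rfl]
  rw [tw.phi_le_iff]
  simp only [Set.mem_singleton_iff, forall_eq, or_self]
  exact ⟨fun h => h.elim (fun h => (y.2.eq_piIn h).le) id, Or.inr⟩

theorem piIn_mem_T {n : ℕ} (y : {x : Set (D × D × D) // IsReducedIn (tw.T n) x}) :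
    piIn y.1 ∈ tw.T n :=
  (y.2.2.1 _ y.2.piIn_mem).1

theorem piIn_le_phi {n : ℕ} (y : {x : Set (D × D × D) // IsReducedIn (tw.T n) x}) :
    piIn y.1 ≤ tw.φ n y :=
  (tw.le_phi_iff (tw.piIn_mem_T y) y).2 le_rfl

theorem phi_mem {n : ℕ} (y : {x : Set (D × D × D) // IsReducedIn (tw.T n) x}) :
    tw.φ n y ∈ tw.T (n + 1) := by
  rw [← tw.phi_range]
  exact ⟨y, rfl⟩

theorem T_subset_succ (n : ℕ) : tw.T n ⊆ tw.T (n + 1) := by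
  intro u hu
  rw [← tw.phi_diag n ⟨_, isReducedIn_singleton hu⟩ u rfl]
  exact tw.phi_mem _

theorem T_mono : Monotone tw.T :=
  monotone_nat_of_le_succ tw.T_subset_succ

variable {B C E : Set D}

theorem FXn_subset_T (hB : B ⊆ S0) : ∀ n, tw.FXn B n ⊆ tw.T n
  | 0 => by rw [tw.T_zero]; exact hB
  | n + 1 => by
    rintro _ ⟨x, rfl, -⟩
    exact tw.phi_mem x

theorem FXn_subset_succ (hB : B ⊆ S0) (n : ℕ) : tw.FXn B n ⊆ tw.FXn B (n + 1) := by
  intro u hu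
  refine ⟨⟨_, isReducedIn_singleton (tw.FXn_subset_T hB n hu)⟩, tw.phi_diag n _ u rfl, ?_⟩
  rintro t rfl
  exact ⟨hu, hu, hu⟩

theorem FXn_mono (hB : B ⊆ S0) : Monotone (tw.FXn B) :=
  monotone_nat_of_le_succ (tw.FXn_subset_succ hB)

theorem FXn_inter_subset (h : B ∩ C ⊆ E) : ∀ n, tw.FXn B n ∩ tw.FXn C n ⊆ tw.FXn E n
  | 0 => h
  | n + 1 => by
    rintro _ ⟨⟨x, rfl, hx⟩, ⟨y, hyx, hy⟩⟩
    obtain rfl := tw.phi_inj n hyx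
    have ih := FXn_inter_subset h n
    exact ⟨y, rfl, fun t ht => ⟨ih ⟨(hx t ht).1, (hy t ht).1⟩,
      ih ⟨(hx t ht).2.1, (hy t ht).2.1⟩, ih ⟨(hx t ht).2.2, (hy t ht).2.2⟩⟩⟩

theorem FXn_mono_left (h : B ⊆ E) (n : ℕ) : tw.FXn B n ⊆ tw.FXn E n := fun _ hd =>
  tw.FXn_inter_subset (B := B) (C := B) (fun _ hx => h hx.1) n ⟨hd, hd⟩

theorem bot_mem_FXn (hB : B ⊆ S0) (hbot : ⊥ ∈ B) (n : ℕ) : ⊥ ∈ tw.FXn B n :=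
  tw.FXn_mono hB (Nat.zero_le n) hbot

theorem exists_le_mem_FXn_zero (hB : B ⊆ S0) {u : D} (hu : u ∈ S0) :
    ∀ {n : ℕ} {m : D}, m ∈ tw.FXn B n → u ≤ m → ∃ m' ∈ B, u ≤ m' ∧ m' ≤ m
  | 0, m, hm, h => ⟨m, hm, h, le_rfl⟩
  | n + 1, m, hm, h => by
    obtain ⟨x, rfl, hx⟩ := hm
    have hun : u ∈ tw.T n := tw.T_mono (Nat.zero_le n) (by rwa [tw.T_zero])
    obtain ⟨m', hm', h₁, h₂⟩ := exists_le_mem_FXn_zero hB hu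
      (hx _ x.2.piIn_mem).1 ((tw.le_phi_iff hun x).1 h)
    exact ⟨m', hm', h₁, h₂.trans (tw.piIn_le_phi x)⟩

/-- The levels of the free distributive extension of a subsemilattice are subsemilattices. -/
theorem supClosed_FXn (hB : B ⊆ S0) (hsup : SupClosed B) : ∀ n, SupClosed (tw.FXn B n)
  | 0 => hsup
  | n + 1 => by
    have ih := supClosed_FXn hB hsup n
    rintro _ ⟨x, rfl, hx⟩ _ ⟨y, rfl, hy⟩
    obtain ⟨z, hz⟩ : tw.φ n x ⊔ tw.φ n y ∈ Set.range (tw.φ n) := by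
      rw [tw.phi_range]
      exact tw.sup_mem _ _ (tw.phi_mem x) _ (tw.phi_mem y)
    have hxz := (tw.phi_le_iff x z).1 (hz ▸ le_sup_left)
    have hyz := (tw.phi_le_iff y z).1 (hz ▸ le_sup_right)
    have hxyz : ∀ t ∈ x.1 ∪ y.1, t ∈ z.1 ∨ t.1 ≤ piIn z.1 ∨ t.2.2 ≤ piIn z.1 :=
      fun t ht => ht.elim (hxz t) (hyz t)
    have hmem : ∀ t ∈ x.1 ∪ y.1, t.1 ∈ tw.FXn B n ∧ t.2.1 ∈ tw.FXn B n ∧ t.2.2 ∈ tw.FXn B n :=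
      fun t ht => ht.elim (hx t) (hy t)
    have hrel : ∀ t ∈ x.1 ∪ y.1, t.2.2 ≤ t.1 ⊔ t.2.1 :=
      fun t ht => ht.elim (fun h => (x.2.2.1 t h).2.2.2) (fun h => (y.2.2.1 t h).2.2.2)
    have hfin : (x.1 ∪ y.1).Finite := x.2.1.union y.2.1
    have hpix : piIn x.1 ≤ piIn z.1 :=
      (tw.le_phi_iff (tw.piIn_mem_T x) z).1 ((tw.piIn_le_phi x).trans (hz ▸ le_sup_left))
    have hpiy : piIn y.1 ≤ piIn z.1 :=
      (tw.le_phi_iff (tw.piIn_mem_T y) z).1 ((tw.piIn_le_phi y).trans (hz ▸ le_sup_right))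
    -- the largest element below `piIn z` that is a join of entries of `x` and `y`
    obtain ⟨p, hpB, hpz, hp⟩ : ∃ p ∈ tw.FXn B n, p ≤ piIn z.1 ∧
        ∀ t ∈ x.1 ∪ y.1, t.2.2 ≤ piIn z.1 → t.2.2 ≤ p := by
      have hW : {t ∈ x.1 ∪ y.1 | t.2.2 ≤ piIn z.1}.Finite := hfin.subset (Set.sep_subset _ _)
      have hne : hW.toFinset.Nonempty :=
        ⟨(piIn x.1, piIn x.1, piIn x.1), hW.mem_toFinset.2 ⟨Or.inl x.2.piIn_mem, hpix⟩⟩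
      refine ⟨hW.toFinset.sup' hne fun t => t.2.2, ih.finsetSup'_mem hne ?_,
        Finset.sup'_le _ _ ?_, fun t ht h =>
          Finset.le_sup' (fun t : D × D × D => t.2.2) (hW.mem_toFinset.2 ⟨ht, h⟩)⟩
      · intro t ht
        exact (hmem t (hW.mem_toFinset.1 ht).1).2.2
      · intro t ht
        exact (hW.mem_toFinset.1 ht).2
    set s : Set (D × D × D) := {t ∈ x.1 ∪ y.1 | ¬t.1 ≤ p ∧ ¬t.2.2 ≤ p}
    have hred : IsReducedIn (tw.T n) (insert (p, p, p) s) := by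
      refine isReducedIn_insert_diag (tw.FXn_subset_T hB n hpB) (hfin.subset (Set.sep_subset _ _))
        ?_ ?_ ?_
      · intro t ht
        have h := hmem t ht.1
        exact ⟨tw.FXn_subset_T hB n h.1, tw.FXn_subset_T hB n h.2.1,
          tw.FXn_subset_T hB n h.2.2, hrel t ht.1⟩
      · intro u v w h₁ h₂
        exact h₁.2.2 (hp _ h₁.1 (z.2.le_piIn_of_mirror (hrel _ h₁.1) (hxyz _ h₁.1) (hxyz _ h₂.1)))
      · intro t ht
        refine ⟨ht.2.1, fun hv => ht.2.2 (hp t ht.1 ?_), ht.2.2⟩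
        exact z.2.le_piIn_of_mirror (u := t.1) (v := t.2.1) (hrel t ht.1) (hxyz t ht.1)
          (Or.inr (Or.inl (hv.trans hpz)))
    have hpi : piIn (insert (p, p, p) s) = p := hred.piIn_insert_diag
    have hub : ∀ t ∈ x.1 ∪ y.1, t ∈ insert (p, p, p) s ∨
        t.1 ≤ piIn (insert (p, p, p) s) ∨ t.2.2 ≤ piIn (insert (p, p, p) s) := by
      intro t ht
      rw [hpi]
      by_cases h₁ : t.1 ≤ p
      · exact Or.inr (Or.inl h₁)
      by_cases h₂ : t.2.2 ≤ p
      · exact Or.inr (Or.inr h₂)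
      exact Or.inl (Or.inr ⟨ht, h₁, h₂⟩)
    refine ⟨⟨_, hred⟩, le_antisymm ?_ (sup_le ?_ ?_), ?_⟩
    · rw [← hz, tw.phi_le_iff]
      rintro t (rfl | ht)
      · exact Or.inr (Or.inl hpz)
      · exact hxyz t ht.1
    · exact (tw.phi_le_iff _ _).2 fun t ht => hub t (Or.inl ht)
    · exact (tw.phi_le_iff _ _).2 fun t ht => hub t (Or.inr ht)
    · rintro t (rfl | ht)
      · exact ⟨hpB, hpB, hpB⟩
      · exact hmem t ht.1

end RTower

/-- In a semilattice with zero, finitely many upward closed conditions that can each be met in a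
subsemilattice can be met simultaneously. -/
theorem SupClosed.exists_forall_of_finite {D ι : Type*} [SemilatticeSup D] [OrderBot D]
    {J : Set D} (hJ : SupClosed J) (hbot : ⊥ ∈ J) {P : ι → D → Prop}
    (hP : ∀ i m m', m ≤ m' → P i m → P i m') {s : Set ι} (hs : s.Finite)
    (h : ∀ i ∈ s, ∃ m ∈ J, P i m) : ∃ m ∈ J, ∀ i ∈ s, P i m := by
  induction s, hs using Set.Finite.induction_on with
  | empty => exact ⟨⊥, hbot, by simp⟩
  | @insert i s _ _ ih =>
    obtain ⟨m, hm, hmP⟩ := ih fun j hj => h j (Or.inr hj)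
    obtain ⟨m', hm', hmP'⟩ := h i (Or.inl rfl)
    refine ⟨m ⊔ m', hJ hm hm', ?_⟩
    rintro j (rfl | hj)
    · exact hP _ _ _ le_sup_right hmP'
    · exact hP _ _ _ le_sup_left (hmP j hj)

namespace RTower

variable {D : Type*} [SemilatticeSup D] [OrderBot D] {S0 : Set D} (tw : RTower D S0)

/-- Lifting of interpolation from `S0` to the levels of its free distributive extension: if every
inequality between `B` and `C` is interpolated by `z ⊔ e` with `z ∈ E` and `e ∈ {⊥, k}`, then so is
every inequality between the `n`-th levels over `B` and `C`, with `z` in the `n`-th level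
over `E`. -/
theorem exists_interpolant {B C E : Set D} (hC : C ⊆ S0) (hE : E ⊆ S0)
    (hsup : SupClosed E) (hbot : ⊥ ∈ E) (hBC : B ∩ C ⊆ E) {k : D} (hk : k ∈ S0)
    (h0 : ∀ x ∈ B, ∀ y ∈ C, x ≤ y → ∃ z ∈ E, ∃ e, (e = ⊥ ∨ e = k) ∧ x ≤ z ⊔ e ∧ z ⊔ e ≤ y) :
    ∀ n, ∀ x ∈ tw.FXn B n, ∀ y ∈ tw.FXn C n, x ≤ y →
      ∃ z ∈ tw.FXn E n, ∃ e, (e = ⊥ ∨ e = k) ∧ x ≤ z ⊔ e ∧ z ⊔ e ≤ y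
  | 0 => h0
  | n + 1 => by
    have ih := exists_interpolant hC hE hsup hbot hBC hk h0 n
    rintro _ ⟨x, rfl, hx⟩ _ ⟨y, rfl, hy⟩ hxy
    rw [tw.phi_le_iff] at hxy
    set J : Set D := {m | m ≤ tw.φ n y ∧
      ∃ z ∈ tw.FXn E (n + 1), ∃ e, (e = ⊥ ∨ e = k) ∧ m = z ⊔ e}
    have hbotE : ⊥ ∈ tw.FXn E (n + 1) := tw.bot_mem_FXn hE hbot _
    have hJ : SupClosed J := by
      rintro _ ⟨hm, z, hz, e, he, rfl⟩ _ ⟨hm', z', hz', e', he', rfl⟩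
      refine ⟨sup_le hm hm', z ⊔ z', tw.supClosed_FXn hE hsup _ hz hz', e ⊔ e', ?_,
        sup_sup_sup_comm _ _ _ _⟩
      rcases he with rfl | rfl <;> rcases he' with rfl | rfl <;> simp
    have hJbot : ⊥ ∈ J := ⟨bot_le, ⊥, hbotE, ⊥, Or.inl rfl, by simp⟩
    have hkT : k ∈ tw.T (n + 1) := tw.T_mono (Nat.zero_le _) (by rwa [tw.T_zero])
    have hJT : J ⊆ tw.T (n + 1) := by
      rintro _ ⟨-, z, hz, e, he, rfl⟩
      refine tw.sup_mem _ _ (tw.FXn_subset_T hE _ hz) _ ?_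
      rcases he with rfl | rfl
      · exact tw.bot_mem _
      · exact hkT
    have hmemJ : ∀ u ∈ tw.FXn B n, u ≤ piIn y.1 → ∃ m ∈ J, u ≤ m := by
      intro u hu huy
      obtain ⟨z, hz, e, he, h₁, h₂⟩ := ih u hu _ (hy _ y.2.piIn_mem).1 huy
      exact ⟨z ⊔ e, ⟨h₂.trans (tw.piIn_le_phi y), z, tw.FXn_subset_succ hE n hz, e, he, rfl⟩, h₁⟩
    -- the part of `x` that lies in `y`
    set s : Set (D × D × D) :=
      {t ∈ x.1 ∩ y.1 | t ≠ (piIn x.1, piIn x.1, piIn x.1)}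
    have hsred : IsReducedIn (tw.T n) (insert (⊥, ⊥, ⊥) s) := by
      refine isReducedIn_insert_diag (tw.bot_mem n) (x.2.1.subset fun t ht => ht.1.1)
        (fun t ht => x.2.2.1 t ht.1.1) ?_ ?_
      · rintro u v w h₁ h₂
        obtain ⟨rfl, rfl⟩ := x.2.2.2.2.1 u v w h₁.1.1 h₂.1.1
        exact h₁.2 (by rw [← x.2.eq_piIn h₁.1.1])
      · intro t ht
        have := x.2.not_le_piIn ht.1.1 ht.2
        exact ⟨fun h => this.1 (h.trans bot_le), fun h => this.2.1 (h.trans bot_le),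
          fun h => this.2.2 (h.trans bot_le)⟩
    have hqJ : tw.φ n ⟨_, hsred⟩ ∈ J := by
      refine ⟨?_, _, ⟨_, rfl, ?_⟩, ⊥, Or.inl rfl, (sup_bot_eq _).symm⟩
      · rw [tw.phi_le_iff]
        rintro t (rfl | ht)
        · exact Or.inr (Or.inl bot_le)
        · exact Or.inl ht.1.2
      · rintro t (rfl | ht)
        · exact ⟨tw.bot_mem_FXn hE hbot n, tw.bot_mem_FXn hE hbot n, tw.bot_mem_FXn hE hbot n⟩
        · have h₁ := hx t ht.1.1
          have h₂ := hy t ht.1.2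
          have hi := tw.FXn_inter_subset hBC n
          exact ⟨hi ⟨h₁.1, h₂.1⟩, hi ⟨h₁.2.1, h₂.2.1⟩, hi ⟨h₁.2.2, h₂.2.2⟩⟩
    obtain ⟨m, hmJ, hm⟩ := hJ.exists_forall_of_finite hJbot
      (P := fun (t : D × D × D) m => tw.φ n ⟨_, hsred⟩ ≤ m ∧ (t ∈ s ∨ t.1 ≤ m ∨ t.2.2 ≤ m))
      (fun t m m' hmm' h => ⟨h.1.trans hmm',
        h.2.imp_right (Or.imp (fun h => h.trans hmm') fun h => h.trans hmm')⟩) x.2.1 (by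
        intro t ht
        have hcase : t ∈ s ∨ t.1 ≤ piIn y.1 ∨ t.2.2 ≤ piIn y.1 := by
          rcases hxy t ht with h | h
          · by_cases hd : t = (piIn x.1, piIn x.1, piIn x.1)
            · subst hd
              exact Or.inr (Or.inl (y.2.eq_piIn h).le)
            · exact Or.inl ⟨⟨ht, h⟩, hd⟩
          · exact Or.inr h
        rcases hcase with h | h | h
        · exact ⟨_, hqJ, le_rfl, Or.inl h⟩
        · obtain ⟨m, hm, hum⟩ := hmemJ _ (hx t ht).1 h
          exact ⟨_, hJ hqJ hm, le_sup_left, Or.inr (Or.inl (hum.trans le_sup_right))⟩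
        · obtain ⟨m, hm, hum⟩ := hmemJ _ (hx t ht).2.2 h
          exact ⟨_, hJ hqJ hm, le_sup_left, Or.inr (Or.inr (hum.trans le_sup_right))⟩)
    have hxm : tw.φ n x ≤ m := by
      obtain ⟨M, rfl⟩ : m ∈ Set.range (tw.φ n) := by
        rw [tw.phi_range]
        exact hJT hmJ
      rw [tw.phi_le_iff]
      intro t ht
      obtain ⟨hq, h⟩ := hm t ht
      have hT := x.2.2.1 t ht
      rw [tw.le_phi_iff hT.1, tw.le_phi_iff hT.2.2.1] at h
      rcases h with h | h
      · exact (tw.phi_le_iff _ _).1 hq t (Or.inr h)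
      · exact Or.inr h
    obtain ⟨hmy, z, hz, e, he, rfl⟩ := hmJ
    exact ⟨z, hz, e, he, hxm, hmy⟩

end RTower

namespace SLamData

variable {D : Type*} [SemilatticeSup D] [OrderBot D] {Λ : Type*} [LinearOrder Λ]
  (sd : SLamData D Λ) {X Y : Set Λ}

theorem SX_mono (h : X ⊆ Y) : sd.SX X ⊆ sd.SX Y :=
  supClosure_mono (Set.union_subset_union_right _ (Set.image_mono h))

theorem supClosed_SX : SupClosed (sd.SX X) := supClosed_supClosure

theorem bot_mem_SX : ⊥ ∈ sd.SX X := subset_supClosure (by simp)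

theorem a_mem_SX : sd.a ∈ sd.SX X := subset_supClosure (by simp)

theorem b_mem_SX : sd.b ∈ sd.SX X := subset_supClosure (by simp)

theorem c_mem_SX {i : Λ} (hi : i ∈ X) : sd.c i ∈ sd.SX X :=
  subset_supClosure (Or.inr ⟨i, hi, rfl⟩)

/-- Normal form of the elements of `S(X)`. -/
theorem mem_SX_cases {d : D} (hd : d ∈ sd.SX X) :
    (d = ⊥ ∨ d = sd.a ∨ d = sd.b ∨ d = sd.a ⊔ sd.b) ∨
      ∃ j ∈ X, d = sd.c j ∨ d = sd.a ⊔ sd.c j ∨ d = sd.b ⊔ sd.c j := by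
  let G : Set D := insert ⊥ (sd.c '' X)
  have hGab : ∀ t ∈ G, t ≤ sd.a ⊔ sd.b := by
    rintro _ (rfl | ⟨i, -, rfl⟩)
    · exact bot_le
    · exact sd.c_le_ab i
  have hG : ∀ t ∈ G, ∀ t' ∈ G, t ⊔ t' ∈ G := by
    rintro _ (rfl | ⟨i, hi, rfl⟩) t' ht'
    · simpa using ht'
    · rcases ht' with rfl | ⟨j, hj, rfl⟩
      · exact Or.inr ⟨i, hi, by simp⟩
      · rcases le_total i j with h | h
        · exact Or.inr ⟨j, hj, (sup_eq_right.2 (sd.c_mono h)).symm⟩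
        · exact Or.inr ⟨i, hi, (sup_eq_left.2 (sd.c_mono h)).symm⟩
  let N : Set D := {d | d = sd.a ⊔ sd.b ∨ ∃ s, (s = ⊥ ∨ s = sd.a ∨ s = sd.b) ∧ ∃ t ∈ G, d = s ⊔ t}
  have hNab : ∀ d ∈ N, d ≤ sd.a ⊔ sd.b := by
    rintro _ (rfl | ⟨s, rfl | rfl | rfl, t, ht, rfl⟩)
    · exact le_rfl
    · exact sup_le bot_le (hGab t ht)
    · exact sup_le le_sup_left (hGab t ht)
    · exact sup_le le_sup_right (hGab t ht)
  have hN : d ∈ N := by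
    refine supClosure_min (t := N) ?_ ?_ hd
    · rintro _ ((rfl | rfl | rfl | rfl) | ⟨i, hi, rfl⟩)
      · exact Or.inr ⟨⊥, by simp, ⊥, Or.inl rfl, by simp⟩
      · exact Or.inr ⟨sd.a, by simp, ⊥, Or.inl rfl, by simp⟩
      · exact Or.inr ⟨sd.b, by simp, ⊥, Or.inl rfl, by simp⟩
      · exact Or.inl rfl
      · exact Or.inr ⟨⊥, by simp, _, Or.inr ⟨i, hi, rfl⟩, by simp⟩
    · intro d hd d' hd'
      rcases hd with rfl | ⟨s, hs, t, ht, rfl⟩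
      · exact Or.inl (sup_eq_left.2 (hNab _ hd'))
      rcases hd' with rfl | ⟨s', hs', t', ht', rfl⟩
      · exact Or.inl (sup_eq_right.2 (hNab _ (Or.inr ⟨s, hs, t, ht, rfl⟩)))
      rw [sup_sup_sup_comm]
      have htt := hG t ht t' ht'
      have hs'' : s ⊔ s' = sd.a ⊔ sd.b ∨ s ⊔ s' = ⊥ ∨ s ⊔ s' = sd.a ∨ s ⊔ s' = sd.b := by
        rcases hs with rfl | rfl | rfl <;> rcases hs' with rfl | rfl | rfl <;> simp [sup_comm]
      rcases hs'' with h | h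
      · exact Or.inl (by rw [h, sup_eq_left.2 (hGab _ htt)])
      · exact Or.inr ⟨_, h, _, htt, rfl⟩
  rcases hN with h | ⟨s, hs, t, rfl | ⟨j, hj, rfl⟩, rfl⟩
  · exact Or.inl (by simp [h])
  · rw [sup_bot_eq]
    exact Or.inl (hs.imp_right (Or.imp_right Or.inl))
  · refine Or.inr ⟨j, hj, ?_⟩
    rcases hs with rfl | rfl | rfl <;> simp

theorem le_of_c_le {d : D} {i j : Λ} (h : sd.c i ≤ d)
    (hd : d = sd.c j ∨ d = sd.a ⊔ sd.c j ∨ d = sd.b ⊔ sd.c j) : i ≤ j := by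
  rcases hd with rfl | rfl | rfl
  · exact sd.c_le_a_sup_c i j (h.trans le_sup_right)
  · exact sd.c_le_a_sup_c i j h
  · exact sd.c_le_b_sup_c i j h

theorem c_le_of_eq {d : D} {j : Λ}
    (hd : d = sd.c j ∨ d = sd.a ⊔ sd.c j ∨ d = sd.b ⊔ sd.c j) : sd.c j ≤ d := by
  rcases hd with rfl | rfl | rfl
  · exact le_rfl
  · exact le_sup_right
  · exact le_sup_right

theorem exists_of_c_le {d : D} (hd : d ∈ sd.SX X) {i : Λ} (h : sd.c i ≤ d) :
    d = sd.a ⊔ sd.b ∨ ∃ j ∈ X, i ≤ j ∧ sd.c j ≤ d := by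
  rcases sd.mem_SX_cases hd with (rfl | rfl | rfl | rfl) | ⟨j, hj, hdj⟩
  · exact absurd (h.trans bot_le) (sd.not_c_le_a i)
  · exact absurd h (sd.not_c_le_a i)
  · exact absurd h (sd.not_c_le_b i)
  · exact Or.inl rfl
  · exact Or.inr ⟨j, hj, sd.le_of_c_le h hdj, sd.c_le_of_eq hdj⟩

theorem SX_inter_subset : sd.SX X ∩ sd.SX Y ⊆ sd.SX (X ∩ Y) := by
  rintro d ⟨hX, hY⟩
  rcases sd.mem_SX_cases hX with (rfl | rfl | rfl | rfl) | ⟨j, hj, hdj⟩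
  · exact sd.bot_mem_SX
  · exact sd.a_mem_SX
  · exact sd.b_mem_SX
  · exact sd.supClosed_SX sd.a_mem_SX sd.b_mem_SX
  rcases sd.exists_of_c_le hY (sd.c_le_of_eq hdj) with rfl | ⟨i, hi, hji, hid⟩
  · exact sd.supClosed_SX sd.a_mem_SX sd.b_mem_SX
  obtain rfl : i = j := le_antisymm (sd.le_of_c_le hid hdj) hji
  have hc : sd.c i ∈ sd.SX (X ∩ Y) := sd.c_mem_SX ⟨hj, hi⟩
  rcases hdj with rfl | rfl | rfl
  · exact hc
  · exact sd.supClosed_SX sd.a_mem_SX hc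
  · exact sd.supClosed_SX sd.b_mem_SX hc

theorem exists_interpolant {k : Λ} (hX : ∀ i ∈ X, i ≤ k) (hY : ∀ j ∈ Y, j ∈ X ∨ k ≤ j)
    {x y : D} (hx : x ∈ sd.SX X) (hy : y ∈ sd.SX Y) (hxy : x ≤ y) :
    ∃ z ∈ sd.SX (X ∩ Y), ∃ e, (e = ⊥ ∨ e = sd.c k) ∧ x ≤ z ⊔ e ∧ z ⊔ e ≤ y := by
  let N : Set D := {x | x ≤ y →
    ∃ z ∈ sd.SX (X ∩ Y), ∃ e, (e = ⊥ ∨ e = sd.c k) ∧ x ≤ z ⊔ e ∧ z ⊔ e ≤ y}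
  have hZ : ∀ z ∈ sd.SX (X ∩ Y), z ∈ N := fun z hz hzy =>
    ⟨z, hz, ⊥, Or.inl rfl, le_sup_left, by simpa using hzy⟩
  refine supClosure_min (t := N) ?_ ?_ hx hxy
  · rintro _ ((rfl | rfl | rfl | rfl) | ⟨i, hi, rfl⟩)
    · exact hZ _ sd.bot_mem_SX
    · exact hZ _ sd.a_mem_SX
    · exact hZ _ sd.b_mem_SX
    · exact hZ _ (sd.supClosed_SX sd.a_mem_SX sd.b_mem_SX)
    · intro hiy
      rcases sd.exists_of_c_le hy hiy with rfl | ⟨j, hj, hij, hjy⟩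
      · exact ⟨_, sd.supClosed_SX sd.a_mem_SX sd.b_mem_SX, ⊥, Or.inl rfl, by simpa using hiy,
          by simp⟩
      · rcases hY j hj with hjX | hkj
        · exact ⟨_, sd.c_mem_SX ⟨hjX, hj⟩, ⊥, Or.inl rfl, by simpa using sd.c_mono hij,
            by simpa using hjy⟩
        · exact ⟨⊥, sd.bot_mem_SX, _, Or.inr rfl, by simpa using sd.c_mono (hX i hi),
            by simpa using (sd.c_mono hkj).trans hjy⟩
  · intro x₁ h₁ x₂ h₂ h
    obtain ⟨z, hz, e, he, hx, hzy⟩ := h₁ (le_sup_left.trans h)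
    obtain ⟨z', hz', e', he', hx', hzy'⟩ := h₂ (le_sup_right.trans h)
    refine ⟨z ⊔ z', sd.supClosed_SX hz hz', e ⊔ e', ?_, ?_, ?_⟩
    · rcases he with rfl | rfl <;> rcases he' with rfl | rfl <;> simp
    · rw [sup_sup_sup_comm]
      exact sup_le_sup hx hx'
    · rw [sup_sup_sup_comm]
      exact sup_le hzy hzy'

theorem exists_finset_mem_FXn (tw : RTower D (sd.SX Set.univ)) :
    ∀ (n : ℕ) {d : D}, d ∈ tw.T n → ∃ X : Finset Λ, d ∈ tw.FXn (sd.SX X) n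
  | 0, d, hd => by
    classical
    rw [tw.T_zero] at hd
    let N : Set D := {d | ∃ X : Finset Λ, d ∈ sd.SX X}
    refine supClosure_min (t := N) ?_ ?_ hd
    · rintro _ ((rfl | rfl | rfl | rfl) | ⟨i, -, rfl⟩)
      · exact ⟨∅, sd.bot_mem_SX⟩
      · exact ⟨∅, sd.a_mem_SX⟩
      · exact ⟨∅, sd.b_mem_SX⟩
      · exact ⟨∅, sd.supClosed_SX sd.a_mem_SX sd.b_mem_SX⟩
      · exact ⟨{i}, sd.c_mem_SX (by simp)⟩
    · rintro x ⟨X, hX⟩ y ⟨Y, hY⟩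
      exact ⟨X ∪ Y, sd.supClosed_SX (sd.SX_mono (by simp) hX) (sd.SX_mono (by simp) hY)⟩
  | n + 1, d, hd => by
    classical
    rw [← tw.phi_range] at hd
    obtain ⟨x, rfl⟩ := hd
    have hmono : ∀ {X Y : Finset Λ}, X ⊆ Y → tw.FXn (sd.SX X) n ⊆ tw.FXn (sd.SX Y) n :=
      fun h => tw.FXn_mono_left (sd.SX_mono (by exact_mod_cast h)) n
    have hmem : ∀ t ∈ x.1, ∃ X ∈ (Set.univ : Set (Finset Λ)), t.1 ∈ tw.FXn (sd.SX X) n ∧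
        t.2.1 ∈ tw.FXn (sd.SX X) n ∧ t.2.2 ∈ tw.FXn (sd.SX X) n := by
      intro t ht
      have h := x.2.2.1 t ht
      obtain ⟨X, hX⟩ := exists_finset_mem_FXn tw n h.1
      obtain ⟨Y, hY⟩ := exists_finset_mem_FXn tw n h.2.1
      obtain ⟨Z, hZ⟩ := exists_finset_mem_FXn tw n h.2.2.1
      exact ⟨X ∪ Y ∪ Z, trivial, hmono (by grind) hX, hmono (by grind) hY, hmono (by grind) hZ⟩
    obtain ⟨X, -, hX⟩ := supClosed_univ.exists_forall_of_finite (Set.mem_univ _)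
      (fun t X Y hXY h => ⟨hmono hXY h.1, hmono hXY h.2.1, hmono hXY h.2.2⟩) x.2.1 hmem
    exact ⟨X, x, rfl, hX⟩

end SLamData

theorem Omega1.exists_forall_lt {ι : Type*} [Countable ι] (f : ι → Omega1) :
    ∃ β : Omega1, ∀ i, f i < β := by
  have hlim : Order.IsSuccLimit (Cardinal.aleph 1).ord :=
    Cardinal.isSuccLimit_ord (Cardinal.aleph0_le_aleph 1)
  have hlt : ∀ i, Order.succ (f i : Ordinal) < Ordinal.omega 1 := fun i => by
    rw [← Cardinal.ord_aleph]
    exact hlim.succ_lt (f i).2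
  have hsup := Ordinal.iSup_lt_omega_one hlt
  refine ⟨⟨⨆ i, Order.succ (f i : Ordinal), hsup.trans_eq (Cardinal.ord_aleph 1).symm⟩, fun i => ?_⟩
  have hbdd : BddAbove (Set.range fun i => Order.succ (f i : Ordinal)) :=
    ⟨Ordinal.omega 1, by rintro _ ⟨i, rfl⟩; exact (hlt i).le⟩
  exact (Order.lt_succ (f i : Ordinal)).trans_le (le_ciSup hbdd i)

theorem Omega1.countable_Iio (α : Omega1) : (Set.Iio α).Countable := by
  have h : (Set.Iio (α : Ordinal)).Countable := by
    rw [← Cardinal.le_aleph0_iff_set_countable, Cardinal.mk_Iio_ordinal, Cardinal.lift_le_aleph0,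
      ← Order.lt_succ_iff, Cardinal.succ_aleph0]
    exact Cardinal.lt_ord.1 α.2
  exact (h.preimage Subtype.val_injective).mono fun β hβ => hβ

/-- Every function from finite subsets of `ω₁` to `ω₁` has a closure point. -/
theorem Omega1.exists_closed (h : Finset Omega1 → Omega1) :
    ∃ δ : Omega1, ∀ Z : Finset Omega1, (∀ i ∈ Z, i < δ) → h Z ≤ δ := by
  have hstep : ∀ α : Omega1, ∃ β : Omega1, α ≤ β ∧
      ∀ Z : Finset Omega1, (∀ i ∈ Z, i < α) → h Z ≤ β := by
    intro α
    have : Countable (Set.Iio α) := (Omega1.countable_Iio α).to_subtype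
    obtain ⟨β, hβ⟩ := Omega1.exists_forall_lt
      fun Z : Finset (Set.Iio α) => h (Z.map (Function.Embedding.subtype _))
    refine ⟨max α β, le_max_left _ _, fun Z hZ => le_max_of_le_right ?_⟩
    have hmap : (Z.subtype (· ∈ Set.Iio α)).map (Function.Embedding.subtype _) = Z :=
      Finset.subtype_map_of_mem hZ
    exact hmap ▸ (hβ (Z.subtype (· ∈ Set.Iio α))).le
  choose g hg hgZ using hstep
  obtain ⟨α₀, -⟩ := Omega1.exists_forall_lt fun i : Empty => i.elim
  let s : ℕ → Omega1 := fun n => g^[n] α₀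
  have hsucc : ∀ n, s (n + 1) = g (s n) := fun n => Function.iterate_succ_apply' g n α₀
  have hs : Monotone s := monotone_nat_of_le_succ fun n => hsucc n ▸ hg (s n)
  obtain ⟨γ, hγ⟩ := Omega1.exists_forall_lt s
  obtain ⟨δ, hδ, hmin⟩ := WellFounded.has_min (wellFounded_lt (α := Omega1))
    {γ | ∀ n, s n ≤ γ} ⟨γ, fun n => (hγ n).le⟩
  refine ⟨δ, fun Z hZ => ?_⟩
  have hcof : ∀ i ∈ Z, ∃ n, i < s n := fun i hi => by
    by_contra! hcon
    exact hmin i hcon (hZ i hi)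
  obtain ⟨n, hn⟩ : ∃ n, ∀ i ∈ Z, i < s n := by
    choose! m hm using hcof
    exact ⟨Z.sup m, fun i hi => (hm i hi).trans_le (hs (Finset.le_sup hi))⟩
  exact (hgZ (s n) Z hn).trans (hsucc n ▸ hδ (n + 1))

/-- Every family of finite subsets of `ω₁` has two members in the position of a `Δ`-system. -/
theorem Omega1.exists_delta_pair (X : Omega1 → Finset Omega1) :
    ∃ ξ η : Omega1, ξ < η ∧ (∀ i ∈ X ξ, i < η) ∧ (∀ j ∈ X η, j ∈ X ξ ∨ η ≤ j) ∧
      ∀ i ∈ X ξ, i ∈ X η → i < ξ := by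
  classical
  have hbound : ∀ Z : Finset Omega1, ∃ β : Omega1, (∃ ξ, (∀ i ∈ Z, i < ξ) ∧ Z ⊆ X ξ) →
      ∃ ξ < β, (∀ i ∈ Z, i < ξ) ∧ Z ⊆ X ξ ∧ ∀ i ∈ X ξ, i < β := by
    intro Z
    by_cases hZ : ∃ ξ, (∀ i ∈ Z, i < ξ) ∧ Z ⊆ X ξ
    · obtain ⟨ξ, h₁, h₂⟩ := hZ
      obtain ⟨β, hβ⟩ := Omega1.exists_forall_lt
        (fun i : (insert ξ (X ξ) : Finset Omega1) => (i : Omega1))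
      exact ⟨β, fun _ => ⟨ξ, hβ ⟨ξ, by simp⟩, h₁, h₂, fun i hi => hβ ⟨i, by simp [hi]⟩⟩⟩
    · obtain ⟨β, -⟩ := Omega1.exists_forall_lt (fun i : Empty => i.elim)
      exact ⟨β, fun h => absurd h hZ⟩
  choose h hh using hbound
  obtain ⟨η, hη⟩ := Omega1.exists_closed h
  have hZη : ∀ i ∈ (X η).filter (· < η), i < η := fun i hi => (Finset.mem_filter.1 hi).2
  obtain ⟨ξ, hξ, h₁, h₂, h₃⟩ := hh ((X η).filter (· < η))
    ⟨η, hZη, Finset.filter_subset _ _⟩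
  have hle := hη _ hZη
  refine ⟨ξ, η, hξ.trans_le hle, fun i hi => (h₃ i hi).trans_le hle, fun j hj => ?_,
    fun i hi hi' => h₁ i (Finset.mem_filter.2 ⟨hi', (h₃ i hi).trans_le hle⟩)⟩
  rcases lt_or_ge j η with hlt | hge
  · exact Or.inl (h₂ (Finset.mem_filter.2 ⟨hj, hlt⟩))
  · exact Or.inr hge

/-- the monotone refinement property fails in `F(ω₁)`: there are no isotone
`ω₁`-sequences `(a_ξ)`, `(b_ξ)` with `a_ξ ≤ a`, `b_ξ ≤ b` and `c_ξ = a_ξ ∨ b_ξ`. -/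
theorem monotone_refinement_fails_in_F_omega1 (D : Type*) [SemilatticeSup D] [OrderBot D]
    (sd : SLamData D Omega1) (tw : RTower D (sd.SX Set.univ)) :
    ¬∃ A B : Omega1 → D, Monotone A ∧ Monotone B ∧
      ∀ ξ : Omega1, A ξ ≤ sd.a ∧ B ξ ≤ sd.b ∧ sd.c ξ = A ξ ⊔ B ξ := by
  classical
  rintro ⟨A, B, hA, hB, hAB⟩
  have hsupp : ∀ d : D, ∃ (n : ℕ) (X : Finset Omega1), d ∈ tw.FXn (sd.SX X) n := by
    intro d
    obtain ⟨n, hn⟩ := Set.mem_iUnion.1 (tw.union_univ ▸ Set.mem_univ d : d ∈ ⋃ n, tw.T n)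
    exact ⟨n, sd.exists_finset_mem_FXn tw n hn⟩
  have hS : ∀ X : Set Omega1, sd.SX X ⊆ sd.SX Set.univ := fun X => sd.SX_mono (Set.subset_univ X)
  have hmono : ∀ {m n : ℕ} {X Y : Finset Omega1}, m ≤ n → X ⊆ Y →
      tw.FXn (sd.SX X) m ⊆ tw.FXn (sd.SX Y) n := fun hmn hXY =>
    (tw.FXn_mono_left (sd.SX_mono (by exact_mod_cast hXY)) _).trans (tw.FXn_mono (hS _) hmn)
  choose nA XA hXA using fun ξ => hsupp (A ξ)
  choose nB XB hXB using fun ξ => hsupp (B ξ)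
  obtain ⟨ξ, η, hξη, hXη, hY, hZ⟩ := Omega1.exists_delta_pair fun ξ => XA ξ ∪ XB ξ
  set n := max (max (nA ξ) (nB ξ)) (max (nA η) (nB η))
  set X : Set Omega1 := ↑(XA ξ ∪ XB ξ)
  set Y : Set Omega1 := ↑(XA η ∪ XB η)
  -- a refinement element below a generator `g` is interpolated over `X ∩ Y`
  have key : ∀ g : D, (¬sd.c η ≤ g) → ∀ x ∈ tw.FXn (sd.SX X) n, ∀ y ∈ tw.FXn (sd.SX Y) n,
      x ≤ y → y ≤ g → ∃ z ∈ tw.FXn (sd.SX (X ∩ Y)) n, x ≤ z ∧ z ≤ y := by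
    intro g hg x hx y hy hxy hyg
    obtain ⟨z, hz, e, he, h₁, h₂⟩ := tw.exists_interpolant (hS Y) (hS (X ∩ Y)) sd.supClosed_SX
      sd.bot_mem_SX sd.SX_inter_subset (sd.c_mem_SX (Set.mem_univ η))
      (fun x hx y hy hxy => sd.exists_interpolant (fun i hi => (hXη i hi).le) hY hx hy hxy)
      n x hx y hy hxy
    rcases he with rfl | rfl
    · exact ⟨z, hz, by simpa using h₁, by simpa using h₂⟩
    · exact absurd ((le_sup_right.trans h₂).trans hyg) hg
  obtain ⟨z, hz, hAz, hzA⟩ := key sd.a (sd.not_c_le_a η) (A ξ)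
    (hmono (by omega) Finset.subset_union_left (hXA ξ)) (A η)
    (hmono (by omega) Finset.subset_union_left (hXA η)) (hA hξη.le) (hAB η).1
  obtain ⟨z', hz', hBz, hzB⟩ := key sd.b (sd.not_c_le_b η) (B ξ)
    (hmono (by omega) Finset.subset_union_right (hXB ξ)) (B η)
    (hmono (by omega) Finset.subset_union_right (hXB η)) (hB hξη.le) (hAB η).2.1
  obtain ⟨m, hm, hcm, hmz⟩ := tw.exists_le_mem_FXn_zero (hS (X ∩ Y))
    (sd.c_mem_SX (Set.mem_univ ξ)) (tw.supClosed_FXn (hS _) sd.supClosed_SX n hz hz')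
    ((hAB ξ).2.2.le.trans (sup_le_sup hAz hBz))
  have hmc : m ≤ sd.c η := hmz.trans ((sup_le_sup hzA hzB).trans (hAB η).2.2.ge)
  rcases sd.exists_of_c_le hm hcm with rfl | ⟨j, hj, hξj, -⟩
  · exact sd.not_a_le η (le_sup_left.trans (hmc.trans le_sup_right))
  · exact absurd (hZ j hj.1 hj.2) hξj.not_gt
end

section
/- Let P be a lattice and let Conc P be the ∨,0-semilattice of compact (finitely generated) congruences of P. Then the map μ : P × P → Conc P defined by μ(x,y) = Θ(y, x ∨ y), the principal congruence generated by the pair (y, x ∨ y), is a Conc P-valued V-measure on the poset P. -/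
/-- A congruence of the lattice `P`: an equivalence relation compatible with `⊔` and `⊓`. -/
structure LatCon (P : Type*) [Lattice P] where
  r : P → P → Prop
  refl' : ∀ a, r a a
  symm' : ∀ {a b}, r a b → r b a
  trans' : ∀ {a b c}, r a b → r b c → r a c
  sup_comp : ∀ {a b c d}, r a b → r c d → r (a ⊔ c) (b ⊔ d)
  inf_comp : ∀ {a b c d}, r a b → r c d → r (a ⊓ c) (b ⊓ d)

namespace LatCon

variable {P : Type*} [Lattice P]

lemma ext' {c d : LatCon P} (h : c.r = d.r) : c = d := by
  cases c; cases d; cases h; rfl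

/-- Congruences are ordered by inclusion. -/
instance : PartialOrder (LatCon P) where
  le c d := ∀ a b, c.r a b → d.r a b
  le_refl c := fun _ _ h => h
  le_trans c d e h1 h2 := fun a b h => h2 a b (h1 a b h)
  le_antisymm c d h1 h2 := ext' (by funext a b; exact propext ⟨h1 a b, h2 a b⟩)

/-- The least congruence is equality. -/
instance : OrderBot (LatCon P) where
  bot := ⟨Eq, fun _ => rfl, fun h => h.symm, fun h1 h2 => h1.trans h2,
    fun h1 h2 => by rw [h1, h2], fun h1 h2 => by rw [h1, h2]⟩
  bot_le c := fun a b h => h ▸ c.refl' a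

/-- The join of two congruences: the least congruence containing both. -/
instance : SemilatticeSup (LatCon P) where
  sup c d := ⟨fun a b => ∀ e : LatCon P, (∀ x y, c.r x y → e.r x y) →
      (∀ x y, d.r x y → e.r x y) → e.r a b,
    fun a e _ _ => e.refl' a,
    fun h e hc hd => e.symm' (h e hc hd),
    fun h1 h2 e hc hd => e.trans' (h1 e hc hd) (h2 e hc hd),
    fun h1 h2 e hc hd => e.sup_comp (h1 e hc hd) (h2 e hc hd),
    fun h1 h2 e hc hd => e.inf_comp (h1 e hc hd) (h2 e hc hd)⟩
  le_sup_left c d := fun a b h e hc _ => hc a b h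
  le_sup_right c d := fun a b h e _ hd => hd a b h
  sup_le c d e h1 h2 := fun a b h => h e h1 h2

/-- The principal congruence `Θ(u,v)`: the least congruence identifying `u` and `v`. -/
def theta (u v : P) : LatCon P :=
  ⟨fun a b => ∀ e : LatCon P, e.r u v → e.r a b,
    fun a e _ => e.refl' a,
    fun h e he => e.symm' (h e he),
    fun h1 h2 e he => e.trans' (h1 e he) (h2 e he),
    fun h1 h2 e he => e.sup_comp (h1 e he) (h2 e he),
    fun h1 h2 e he => e.inf_comp (h1 e he) (h2 e he)⟩

/-- A congruence is compact, i.e. finitely generated: a finite join of principal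
congruences. -/
def FinGen (c : LatCon P) : Prop :=
  ∃ l : List (P × P), c = (l.map fun p => theta p.1 p.2).foldr (· ⊔ ·) ⊥

end LatCon

/-- `Θ⁺(x,y) = Θ(y, x ∨ y)`. -/
def thetaPlus {P : Type*} [Lattice P] (x y : P) : LatCon P := LatCon.theta y (x ⊔ y)

namespace LatCon

variable {P : Type*} [Lattice P]

lemma theta_le {u v : P} {c : LatCon P} (h : c.r u v) : theta u v ≤ c :=
  fun _ _ hab => hab c h

lemma theta_r (u v : P) : (theta u v).r u v := fun _ h => h

/-- The join of two congruences, described through finite alternating paths. -/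
def pathJoin (A B : LatCon P) : LatCon P where
  r := Relation.ReflTransGen fun a b => A.r a b ∨ B.r a b
  refl' _ := .refl
  symm' h := by
    induction h with
    | refl => exact .refl
    | tail _ h ih => exact .head (h.imp A.symm' B.symm') ih
  trans' := .trans
  sup_comp {_ b c _} h h' :=
    (h.lift (· ⊔ c) fun _ _ =>
        Or.imp (A.sup_comp · (A.refl' c)) (B.sup_comp · (B.refl' c))).trans
      (h'.lift (b ⊔ ·) fun _ _ => Or.imp (A.sup_comp (A.refl' b)) (B.sup_comp (B.refl' b)))
  inf_comp {_ b c _} h h' :=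
    (h.lift (· ⊓ c) fun _ _ =>
        Or.imp (A.inf_comp · (A.refl' c)) (B.inf_comp · (B.refl' c))).trans
      (h'.lift (b ⊓ ·) fun _ _ => Or.imp (A.inf_comp (A.refl' b)) (B.inf_comp (B.refl' b)))

lemma sup_le_pathJoin (A B : LatCon P) : A ⊔ B ≤ pathJoin A B :=
  sup_le (fun _ _ h => .single (.inl h)) (fun _ _ h => .single (.inr h))

/-- One step of an ascending chain, within a class of `A` or of `B`. -/
def AscStep (A B : LatCon P) (a b : P) : Prop := a ≤ b ∧ (A.r a b ∨ B.r a b)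

lemma exists_ascending_of_pathJoin {A B : LatCon P} {a b : P} (h : (pathJoin A B).r a b) :
    ∃ c, b ≤ c ∧ Relation.ReflTransGen (AscStep A B) a c := by
  induction h with
  | refl => exact ⟨a, le_rfl, .refl⟩
  | @tail b d _ h ih =>
    obtain ⟨c, hbc, hc⟩ := ih
    refine ⟨c ⊔ d, le_sup_right, hc.tail ⟨le_sup_left, ?_⟩⟩
    have hcb : c ⊔ b = c := sup_eq_left.mpr hbc
    exact h.imp (fun h => by simpa only [hcb] using A.sup_comp (A.refl' c) h)
      fun h => by simpa only [hcb] using B.sup_comp (B.refl' c) h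

lemma ascending_of_sup {A B : LatCon P} {x y : P} (hxy : x ≤ y) (h : (A ⊔ B).r x y) :
    Relation.ReflTransGen (AscStep A B) x y := by
  obtain ⟨c, hyc, hc⟩ := exists_ascending_of_pathJoin (sup_le_pathJoin A B _ _ h)
  have hlift : Relation.ReflTransGen (AscStep A B) (x ⊓ y) (c ⊓ y) := hc.lift (· ⊓ y) fun _ _ hab =>
    ⟨inf_le_inf_right y hab.1,
      hab.2.imp (A.inf_comp · (A.refl' y)) (B.inf_comp · (B.refl' y))⟩
  rwa [inf_eq_left.mpr hxy, inf_eq_right.mpr hyc] at hlift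

end LatCon

lemma exists_seq_of_reflTransGen {α : Type*} {s : α → α → Prop} (hs : ∀ a, s a a) {a b : α}
    (h : Relation.ReflTransGen s a b) :
    ∃ (n : ℕ) (z : ℕ → α), 0 < n ∧ z 0 = a ∧ z n = b ∧ ∀ i < n, s (z i) (z (i + 1)) := by
  induction h using Relation.ReflTransGen.head_induction_on with
  | refl => exact ⟨1, fun _ => b, one_pos, rfl, rfl, fun _ _ => hs b⟩
  | @head a c hac _ ih =>
    obtain ⟨n, z, -, h0, hn, hz⟩ := ih
    refine ⟨n + 1, fun i => i.casesOn a z, n.succ_pos, rfl, hn, fun i hi => ?_⟩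
    cases i with
    | zero => simpa [h0] using hac
    | succ i => exact hz i (by omega)

lemma thetaPlus_le_of_le {P : Type*} [Lattice P] {x y : P} {c : LatCon P} (hxy : x ≤ y)
    (h : c.r x y) : thetaPlus y x ≤ c :=
  LatCon.theta_le (by rwa [sup_eq_left.mpr hxy])

lemma thetaPlus_triangle {P : Type*} [Lattice P] (x y z : P) :
    thetaPlus x z ≤ thetaPlus x y ⊔ thetaPlus y z := by
  set e := thetaPlus x y ⊔ thetaPlus y z
  have hxy : e.r y (x ⊔ y) :=
    (le_sup_left : thetaPlus x y ≤ e) _ _ (LatCon.theta_r _ _)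
  have hyz : e.r z (y ⊔ z) :=
    (le_sup_right : thetaPlus y z ≤ e) _ _ (LatCon.theta_r _ _)
  have hz : e.r z (x ⊔ y ⊔ z) := e.trans' hyz (e.sup_comp hxy (e.refl' z))
  have hle : x ⊔ z ≤ x ⊔ y ⊔ z := sup_le_sup_right le_sup_left z
  have hinf := e.inf_comp hz (e.refl' (x ⊔ z))
  rw [inf_eq_left.mpr le_sup_right, inf_eq_right.mpr hle] at hinf
  exact LatCon.theta_le hinf

/-- for a lattice `P`, the map `μ(x,y) = Θ⁺(x,y) = Θ(y, x ∨ y)` is a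
`Conc P`-valued V-measure on the poset `P`: its values are compact (finitely generated)
congruences, it is a poset measure, and it satisfies the V-condition with respect to
compact congruences. -/
theorem thetaPlus_is_V_measure (P : Type*) [Lattice P] :
    (∀ x y : P, (thetaPlus x y).FinGen) ∧
    (∀ x y : P, x ≤ y → thetaPlus x y = (⊥ : LatCon P)) ∧
    (∀ x y z : P, thetaPlus x z ≤ thetaPlus x y ⊔ thetaPlus y z) ∧
    (∀ x y : P, x ≤ y → ∀ A B : LatCon P, A.FinGen → B.FinGen →
      thetaPlus y x ≤ A ⊔ B →
      ∃ (n : ℕ) (z : ℕ → P), 0 < n ∧ z 0 = x ∧ z n = y ∧ (∀ i < n, z i ≤ z (i + 1)) ∧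
        ∀ i < n, thetaPlus (z (i + 1)) (z i) ≤ A ∨ thetaPlus (z (i + 1)) (z i) ≤ B) := by
  refine ⟨fun x y => ⟨[(y, x ⊔ y)], by simp [thetaPlus]⟩, fun x y hxy => ?_,
    thetaPlus_triangle, fun x y hxy A B _ _ h => ?_⟩
  · exact le_bot_iff.mp (LatCon.theta_le (sup_eq_right.mpr hxy).symm)
  · have hr : (A ⊔ B).r x y := by
      simpa only [sup_eq_left.mpr hxy] using h _ _ (LatCon.theta_r x (y ⊔ x))
    obtain ⟨n, z, hn, h0, hy, hz⟩ := exists_seq_of_reflTransGen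
      (fun a => ⟨le_rfl, .inl (A.refl' a)⟩) (LatCon.ascending_of_sup hxy hr)
    exact ⟨n, z, hn, h0, hy, fun i hi => (hz i hi).1, fun i hi =>
      (hz i hi).2.imp (thetaPlus_le_of_le (hz i hi).1) (thetaPlus_le_of_le (hz i hi).1)⟩
end
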